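/- arXiv:1203.4553 — 2 statements merged into one kernel-verified Lean document; each statement's English description precedes it below -/
import Mathlib

section
/- Suppose α is an isophote with axis d and angle θ, κ(s) > 0 for all s, τ_g(s) = 0 for all s, and k_n(s) ≠ 0 for all s (α is a line of curvature). Then k_n(s)²·cos²θ = k_g(s)²·sin²θ for all s, and τ(s) = 0 for all s (α is a plane curve). -/
open scoped RealInnerProductSpace

noncomputable section

/-- The cross product on `EuclideanSpace ℝ (Fin 3)`. -/
def cross3 (u v : EuclideanSpace ℝ (Fin 3)) : EuclideanSpace ℝ (Fin 3) :=
  (EuclideanSpace.equiv (Fin 3) ℝ).symm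
    (crossProduct ((EuclideanSpace.equiv (Fin 3) ℝ) u) ((EuclideanSpace.equiv (Fin 3) ℝ) v))

@[simp] lemma cross3_apply_zero (u v : EuclideanSpace ℝ (Fin 3)) :
    cross3 u v 0 = u 1 * v 2 - u 2 * v 1 := by
  simp [cross3, cross_apply]

@[simp] lemma cross3_apply_one (u v : EuclideanSpace ℝ (Fin 3)) :
    cross3 u v 1 = u 2 * v 0 - u 0 * v 2 := by
  simp [cross3, cross_apply]

@[simp] lemma cross3_apply_two (u v : EuclideanSpace ℝ (Fin 3)) :
    cross3 u v 2 = u 0 * v 1 - u 1 * v 0 := by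
  simp [cross3, cross_apply]

lemma inner_cross3_self_left (u v : EuclideanSpace ℝ (Fin 3)) : ⟪cross3 u v, u⟫ = 0 := by
  simp only [PiLp.inner_apply, Fin.sum_univ_three, RCLike.inner_apply, conj_trivial,
    cross3_apply_zero, cross3_apply_one, cross3_apply_two]
  ring

lemma differentiable_cross3 {f g : ℝ → EuclideanSpace ℝ (Fin 3)}
    (hf : Differentiable ℝ f) (hg : Differentiable ℝ g) :
    Differentiable ℝ fun s => cross3 (f s) (g s) := by
  rw [differentiable_euclidean] at hf hg ⊢
  have hf0 := hf 0
  have hf1 := hf 1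
  have hf2 := hf 2
  have hg0 := hg 0
  have hg1 := hg 1
  have hg2 := hg 2
  intro i
  fin_cases i <;> simp <;> fun_prop

/-- The product of two triple products with a common pair of vectors is a Gram determinant. -/
lemma inner_cross3_mul_inner_cross3 (a b u v : EuclideanSpace ℝ (Fin 3)) :
    ⟪u, cross3 a b⟫ * ⟪v, cross3 a b⟫ =
      ⟪a, a⟫ * (⟪b, b⟫ * ⟪u, v⟫ - ⟪v, b⟫ * ⟪u, b⟫) -
        ⟪a, b⟫ * (⟪a, b⟫ * ⟪u, v⟫ - ⟪v, b⟫ * ⟪u, a⟫) +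
        ⟪v, a⟫ * (⟪a, b⟫ * ⟪u, b⟫ - ⟪b, b⟫ * ⟪u, a⟫) := by
  simp only [PiLp.inner_apply, Fin.sum_univ_three, RCLike.inner_apply, conj_trivial,
    cross3_apply_zero, cross3_apply_one, cross3_apply_two]
  ring

/-- Parseval's identity for the orthonormal frame `a, b, a × b`. -/
lemma inner_eq_of_orthonormal_pair {a b : EuclideanSpace ℝ (Fin 3)} (ha : ‖a‖ = 1)
    (hb : ‖b‖ = 1) (hab : ⟪a, b⟫ = 0) (u v : EuclideanSpace ℝ (Fin 3)) :
    ⟪u, v⟫ = ⟪u, a⟫ * ⟪v, a⟫ + ⟪u, b⟫ * ⟪v, b⟫ + ⟪u, cross3 a b⟫ * ⟪v, cross3 a b⟫ := by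
  rw [inner_cross3_mul_inner_cross3, real_inner_self_eq_norm_sq, real_inner_self_eq_norm_sq,
    ha, hb, hab]
  ring

/-- Three vectors of `ℝ³` orthogonal to a common nonzero vector have zero triple product. -/
lemma inner_cross3_eq_zero_of_orthogonal {u v w d : EuclideanSpace ℝ (Fin 3)} (hd : d ≠ 0)
    (hu : ⟪u, d⟫ = 0) (hv : ⟪v, d⟫ = 0) (hw : ⟪w, d⟫ = 0) : ⟪cross3 u v, w⟫ = 0 := by
  have key : ⟪cross3 u v, w⟫ * ⟪d, d⟫ =
      ⟪u, d⟫ * ⟪cross3 v w, d⟫ + ⟪v, d⟫ * ⟪cross3 w u, d⟫ + ⟪w, d⟫ * ⟪cross3 u v, d⟫ := by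
    simp only [PiLp.inner_apply, Fin.sum_univ_three, RCLike.inner_apply, conj_trivial,
      cross3_apply_zero, cross3_apply_one, cross3_apply_two]
    ring
  rw [hu, hv, hw] at key
  simpa [hd] using key

/-- Leibniz rule for a constant inner product. -/
lemma inner_deriv_add_inner_deriv_eq_zero {E : Type*} [NormedAddCommGroup E]
    [InnerProductSpace ℝ E] {f g : ℝ → E} (hf : Differentiable ℝ f) (hg : Differentiable ℝ g)
    {c : ℝ} (h : ∀ s, ⟪f s, g s⟫ = c) (s : ℝ) : ⟪f s, deriv g s⟫ + ⟪deriv f s, g s⟫ = 0 := by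
  rw [← deriv_inner_apply ℝ (hf s) (hg s), funext h, deriv_const]

/-- If `f` has constant inner product with `d`, then `f'` is orthogonal to `d`. -/
lemma inner_deriv_eq_zero {E : Type*} [NormedAddCommGroup E]
    [InnerProductSpace ℝ E] {f : ℝ → E} (hf : Differentiable ℝ f) {d : E}
    {c : ℝ} (h : ∀ s, ⟪f s, d⟫ = c) (s : ℝ) : ⟪deriv f s, d⟫ = 0 := by
  simpa using inner_deriv_add_inner_deriv_eq_zero hf (differentiable_const d) h s

theorem stmt6
    (α N : ℝ → EuclideanSpace ℝ (Fin 3))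
    (hα : ContDiff ℝ (⊤ : ℕ∞) α) (hN : ContDiff ℝ (⊤ : ℕ∞) N)
    (hunit : ∀ s, ‖deriv α s‖ = 1)
    (hNunit : ∀ s, ‖N s‖ = 1)
    (hNT : ∀ s, ⟪N s, deriv α s⟫ = 0)
    (T B : ℝ → EuclideanSpace ℝ (Fin 3))
    (hT : ∀ s, T s = deriv α s)
    (hB : ∀ s, B s = cross3 (N s) (T s))
    (kn kg τg : ℝ → ℝ)
    (hkn : ∀ s, kn s = ⟪deriv T s, N s⟫)
    (hkg : ∀ s, kg s = ⟪deriv T s, B s⟫)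
    (hτg : ∀ s, τg s = ⟪deriv B s, N s⟫)
    (κ τ : ℝ → ℝ) (n b : ℝ → EuclideanSpace ℝ (Fin 3))
    (hκ : ∀ s, κ s = ‖deriv (deriv α) s‖)
    (hκpos : ∀ s, 0 < κ s)
    (hn : ∀ s, n s = (κ s)⁻¹ • deriv (deriv α) s)
    (hb : ∀ s, b s = cross3 (deriv α s) (n s))
    (hτ : ∀ s, τ s = ⟪cross3 (deriv α s) (deriv (deriv α) s), deriv (deriv (deriv α)) s⟫ / κ s ^ 2)
    (d : EuclideanSpace ℝ (Fin 3)) (hd : ‖d‖ = 1) (θ : ℝ)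
    (hiso : ∀ s, ⟪N s, d⟫ = Real.cos θ)
    (hloc : ∀ s, τg s = 0) (hknne : ∀ s, kn s ≠ 0) :
    (∀ s, kn s ^ 2 * Real.cos θ ^ 2 = kg s ^ 2 * Real.sin θ ^ 2) ∧
      ∀ s, τ s = 0 := by
  obtain rfl : T = deriv α := funext hT
  obtain rfl : B = fun s => cross3 (N s) (deriv α s) := funext hB
  have smooth_deriv {f : ℝ → EuclideanSpace ℝ (Fin 3)} (hf : ContDiff ℝ (⊤ : ℕ∞) f) :
      ContDiff ℝ (⊤ : ℕ∞) (deriv f) := (contDiff_infty_iff_deriv.mp hf).2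
  have hdiff {f : ℝ → EuclideanSpace ℝ (Fin 3)} (hf : ContDiff ℝ (⊤ : ℕ∞) f) :
      Differentiable ℝ f := (contDiff_infty_iff_deriv.mp hf).1
  have dN := hdiff hN
  have dT := hdiff (smooth_deriv hα)
  have dT' := hdiff (smooth_deriv (smooth_deriv hα))
  have frame s := inner_eq_of_orthonormal_pair (hNunit s) (hunit s) (hNT s)
  have hTd s : ⟪deriv α s, d⟫ = 0 := by
    have h1 := inner_deriv_eq_zero dN hiso s
    have h2 : ⟪deriv N s, N s⟫ = 0 := by
      have h := inner_deriv_add_inner_deriv_eq_zero dN dN (c := 1) (fun s => by simp [hNunit s]) s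
      rw [real_inner_comm] at h
      linarith
    have h3 : ⟪deriv N s, deriv α s⟫ = -kn s := by
      have h := inner_deriv_add_inner_deriv_eq_zero dN dT hNT s
      rw [real_inner_comm, ← hkn] at h
      linarith
    have h4 : ⟪cross3 (N s) (deriv α s), deriv N s⟫ = 0 := by
      have h := inner_deriv_add_inner_deriv_eq_zero (differentiable_cross3 dN dT) dN
        (fun s => inner_cross3_self_left (N s) (deriv α s)) s
      rwa [← hτg, hloc, add_zero] at h
    rw [frame s, h2, h3, real_inner_comm, real_inner_comm _ (deriv N s), h4] at h1
    simpa [hknne s, real_inner_comm] using h1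
  have hT'd := inner_deriv_eq_zero dT hTd
  have hT''d := inner_deriv_eq_zero dT' hT'd
  have hd0 : d ≠ 0 := by
    rintro rfl
    simp at hd
  refine ⟨fun s => ?_, fun s => ?_⟩
  · have h1 := hT'd s
    have h2 := frame s d d
    rw [frame s, ← hkn, ← hkg, real_inner_comm (N s) d, hiso, real_inner_comm (deriv α s) d,
      hTd] at h1
    rw [real_inner_self_eq_norm_sq, hd, real_inner_comm (N s) d, hiso,
      real_inner_comm (deriv α s) d, hTd] at h2
    have h3 := Real.sin_sq_add_cos_sq θ
    linear_combination (Real.cos θ * kn s - kg s * ⟪d, cross3 (N s) (deriv α s)⟫) * h1 -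
      kg s ^ 2 * (h2 + h3)
  · rw [hτ, inner_cross3_eq_zero_of_orthogonal hd0 (hTd s) (hT'd s) (hT''d s), zero_div]
end
end

section
/- α is a slant helix (i.e. there exists a unit vector d ∈ ℝ³ such that the function s ↦ ⟪n(s), d⟫ is constant) if and only if the function σ(s) := (κ(s)²/(κ(s)² + τ(s)²)^{3/2})·(τ/κ)'(s) is constant. -/
open scoped RealInnerProductSpace

noncomputable section

open scoped ContDiff

theorem cross3_coords (u v : EuclideanSpace ℝ (Fin 3)) :
    cross3 u v 0 = u 1 * v 2 - u 2 * v 1 ∧ cross3 u v 1 = u 2 * v 0 - u 0 * v 2 ∧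
      cross3 u v 2 = u 0 * v 1 - u 1 * v 0 := by
  simp [cross3, cross_apply, EuclideanSpace.equiv]

theorem inner_eq_three_coords (u v : EuclideanSpace ℝ (Fin 3)) :
    ⟪u, v⟫ = u 0 * v 0 + u 1 * v 1 + u 2 * v 2 := by
  simp [PiLp.inner_apply, Fin.sum_univ_three, mul_comm]

theorem cross3_smul_right (c : ℝ) (u v : EuclideanSpace ℝ (Fin 3)) :
    cross3 u (c • v) = c • cross3 u v := by
  simp [cross3]

theorem inner_self_cross3 (u v : EuclideanSpace ℝ (Fin 3)) : ⟪u, cross3 u v⟫ = 0 := by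
  obtain ⟨h0, h1, h2⟩ := cross3_coords u v
  rw [inner_eq_three_coords, h0, h1, h2]; ring

theorem inner_cross3_self (u v : EuclideanSpace ℝ (Fin 3)) : ⟪v, cross3 u v⟫ = 0 := by
  obtain ⟨h0, h1, h2⟩ := cross3_coords u v
  rw [inner_eq_three_coords, h0, h1, h2]; ring

theorem inner_cross3_cross3 (u v w x : EuclideanSpace ℝ (Fin 3)) :
    ⟪cross3 u v, cross3 w x⟫ = ⟪u, w⟫ * ⟪v, x⟫ - ⟪u, x⟫ * ⟪v, w⟫ := by
  obtain ⟨h0, h1, h2⟩ := cross3_coords u v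
  obtain ⟨k0, k1, k2⟩ := cross3_coords w x
  simp only [inner_eq_three_coords, h0, h1, h2, k0, k1, k2]; ring

theorem DifferentiableAt.cross3 {f g : ℝ → EuclideanSpace ℝ (Fin 3)} {s : ℝ}
    (hf : DifferentiableAt ℝ f s) (hg : DifferentiableAt ℝ g s) :
    DifferentiableAt ℝ (fun u => cross3 (f u) (g u)) s := by
  rw [differentiableAt_euclidean] at hf hg ⊢
  intro i
  fin_cases i
  · simp only [Fin.zero_eta, (cross3_coords _ _).1]
    exact ((hf 1).mul (hg 2)).sub ((hf 2).mul (hg 1))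
  · simp only [Fin.mk_one, (cross3_coords _ _).2.1]
    exact ((hf 2).mul (hg 0)).sub ((hf 0).mul (hg 2))
  · simp only [Fin.reduceFinMk, (cross3_coords _ _).2.2]
    exact ((hf 0).mul (hg 1)).sub ((hf 1).mul (hg 0))

theorem Orthonormal.eq_sum_inner_three {t n b : EuclideanSpace ℝ (Fin 3)}
    (h : Orthonormal ℝ ![t, n, b]) (v : EuclideanSpace ℝ (Fin 3)) :
    v = ⟪t, v⟫ • t + ⟪n, v⟫ • n + ⟪b, v⟫ • b := by
  have hB := (basisOfOrthonormalOfCardEqFinrank h (by simp)).toOrthonormalBasis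
    (by rwa [coe_basisOfOrthonormalOfCardEqFinrank])|>.sum_repr' v
  simpa [Fin.sum_univ_three] using hB.symm

theorem orthonormal_cross3 {t n : EuclideanSpace ℝ (Fin 3)} (ht : ⟪t, t⟫ = 1)
    (hn : ⟪n, n⟫ = 1) (htn : ⟪t, n⟫ = 0) : Orthonormal ℝ ![t, n, cross3 t n] := by
  have hnt : ⟪n, t⟫ = 0 := by rw [real_inner_comm, htn]
  have hb : ⟪cross3 t n, cross3 t n⟫ = 1 := by
    rw [inner_cross3_cross3, ht, hn, htn, hnt]; norm_num
  have hbt : ⟪cross3 t n, t⟫ = 0 := by rw [real_inner_comm, inner_self_cross3]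
  have hbn : ⟪cross3 t n, n⟫ = 0 := by rw [real_inner_comm, inner_cross3_self]
  rw [orthonormal_iff_ite]
  intro i j
  fin_cases i <;> fin_cases j <;>
    simp [-inner_self_eq_norm_sq_to_K, ht, hn, htn, hnt, hb, hbt, hbn, inner_self_cross3, inner_cross3_self]

theorem HasDerivAt.inner_add_inner_eq_zero {f g : ℝ → EuclideanSpace ℝ (Fin 3)}
    {f' g' : EuclideanSpace ℝ (Fin 3)} {c s : ℝ} (hf : HasDerivAt f f' s) (hg : HasDerivAt g g' s)
    (h : ∀ u, ⟪f u, g u⟫ = c) : ⟪f s, g'⟫ + ⟪f', g s⟫ = 0 := by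
  have h1 := hf.inner ℝ hg
  simp only [h] at h1
  exact h1.unique (hasDerivAt_const s c)

/-- An orthonormal frame along a curve satisfying the Frenet–Serret equations. -/
structure IsFrenetFrame (t n b : ℝ → EuclideanSpace ℝ (Fin 3)) (κ τ : ℝ → ℝ) : Prop where
  orthonormal : ∀ s, Orthonormal ℝ ![t s, n s, b s]
  tangent : ∀ s, HasDerivAt t (κ s • n s) s
  normal : ∀ s, HasDerivAt n (-κ s • t s + τ s • b s) s
  binormal : ∀ s, HasDerivAt b (-τ s • n s) s

namespace IsFrenetFrame

variable {t n b : ℝ → EuclideanSpace ℝ (Fin 3)} {κ τ : ℝ → ℝ}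

theorem of_hasDerivAt (hκ : ∀ s, 0 < κ s) (ht : ∀ s, ⟪t s, t s⟫ = 1) (hn : ∀ s, ⟪n s, n s⟫ = 1)
    (ht' : ∀ s, HasDerivAt t (κ s • n s) s) (hnd : Differentiable ℝ n)
    (hb : ∀ s, b s = cross3 (t s) (n s)) (hτ : ∀ s, ⟪b s, deriv n s⟫ = τ s) :
    IsFrenetFrame t n b κ τ := by
  have htn : ∀ s, ⟪t s, n s⟫ = 0 := fun s => by
    have h := (ht' s).inner_add_inner_eq_zero (ht' s) ht
    rw [real_inner_smul_left, real_inner_smul_right, real_inner_comm] at h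
    have := (hκ s).ne'
    rw [real_inner_comm]
    exact (mul_eq_zero.mp (by linarith : κ s * ⟪n s, t s⟫ = 0)).resolve_left this
  have hort : ∀ s, Orthonormal ℝ ![t s, n s, b s] := fun s => by
    rw [hb s]; exact orthonormal_cross3 (ht s) (hn s) (htn s)
  have hn' : ∀ s, HasDerivAt n (-κ s • t s + τ s • b s) s := fun s => by
    have hd := (hnd s).hasDerivAt
    have h1 := (ht' s).inner_add_inner_eq_zero hd htn
    have h2 := hd.inner_add_inner_eq_zero hd hn
    rw [real_inner_smul_left, hn] at h1
    rw [real_inner_comm] at h2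
    have h3 : ⟪t s, deriv n s⟫ = -κ s := by linarith
    have h4 : ⟪n s, deriv n s⟫ = 0 := by linarith [real_inner_comm (n s) (deriv n s)]
    have h5 := (hort s).eq_sum_inner_three (deriv n s)
    rw [h3, h4, hτ, zero_smul, add_zero] at h5
    rwa [h5] at hd
  refine ⟨hort, ht', hn', fun s => ?_⟩
  have hbd : DifferentiableAt ℝ b s := by
    rw [funext hb]; exact (ht' s).differentiableAt.cross3 (hnd s)
  have hd := hbd.hasDerivAt
  have htb : ∀ s, ⟪t s, b s⟫ = 0 := fun s => by rw [hb s, inner_self_cross3 (t s)]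
  have hnb : ∀ s, ⟪n s, b s⟫ = 0 := fun s => by rw [hb s, inner_cross3_self (t s)]
  have hbb : ∀ s, ⟪b s, b s⟫ = 1 := fun s => by
    rw [real_inner_self_eq_norm_sq, show ‖b s‖ = 1 from (hort s).1 2, one_pow]
  have h1 := (ht' s).inner_add_inner_eq_zero hd htb
  have h2 := (hn' s).inner_add_inner_eq_zero hd hnb
  have h3 := hd.inner_add_inner_eq_zero hd hbb
  rw [real_inner_smul_left, hnb] at h1
  rw [inner_add_left, real_inner_smul_left, real_inner_smul_left, htb, hbb] at h2
  have h4 : ⟪t s, deriv b s⟫ = 0 := by linarith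
  have h5 : ⟪n s, deriv b s⟫ = -τ s := by linarith
  have h6 : ⟪b s, deriv b s⟫ = 0 := by linarith [real_inner_comm (b s) (deriv b s)]
  have h7 := (hort s).eq_sum_inner_three (deriv b s)
  rw [h4, h5, h6, zero_smul, zero_smul, zero_add, add_zero] at h7
  rwa [h7] at hd

theorem inner_sq_add (h : IsFrenetFrame t n b κ τ) (d : EuclideanSpace ℝ (Fin 3)) (s : ℝ) :
    ⟪t s, d⟫ ^ 2 + ⟪n s, d⟫ ^ 2 + ⟪b s, d⟫ ^ 2 = ‖d‖ ^ 2 := by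
  have h1 := congrArg (fun v => ⟪v, d⟫) ((h.orthonormal s).eq_sum_inner_three d)
  simp only [inner_add_left, real_inner_smul_left, real_inner_self_eq_norm_sq] at h1
  rw [h1]; ring

/-- If `n` makes a constant angle with a unit vector `d`, then the geodesic curvature of the
normal indicatrix is constant. -/
theorem sigma_const_of_inner_const (h : IsFrenetFrame t n b κ τ) (hκ : ∀ s, 0 < κ s)
    {d : EuclideanSpace ℝ (Fin 3)} (hd : ‖d‖ = 1) {c : ℝ} (hc : ∀ s, ⟪n s, d⟫ = c) :
    ∃ m, ∀ s, κ s ^ 2 / √((κ s ^ 2 + τ s ^ 2) ^ 3) * deriv (fun u => τ u / κ u) s = m := by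
  set f : ℝ → ℝ := fun s => ⟪t s, d⟫
  set g : ℝ → ℝ := fun s => ⟪b s, d⟫
  have hf : ∀ s, HasDerivAt f (κ s * c) s := fun s => by
    simpa [real_inner_smul_left, hc] using (h.tangent s).inner ℝ (hasDerivAt_const s d)
  have hg : ∀ s, HasDerivAt g (-τ s * c) s := fun s => by
    simpa [real_inner_smul_left, hc] using (h.binormal s).inner ℝ (hasDerivAt_const s d)
  have hfg : ∀ s, κ s * f s = τ s * g s := fun s => by
    have := (h.normal s).inner_add_inner_eq_zero (hasDerivAt_const s d) hc
    simp only [inner_zero_right, inner_add_left, real_inner_smul_left] at this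
    linarith
  have hsq : ∀ s, f s ^ 2 + g s ^ 2 = 1 - c ^ 2 := fun s => by
    have := h.inner_sq_add d s
    rw [hc, hd] at this
    linarith
  have hg0 : ∀ s, g s ≠ 0 := by
    intro s hs
    have hfs : f s = 0 := by
      have := hfg s
      rw [hs, mul_zero] at this
      exact (mul_eq_zero.mp this).resolve_left (hκ s).ne'
    have hc1 : 1 - c ^ 2 = 0 := by rw [← hsq s, hs, hfs]; norm_num
    have hf0 : ∀ u, f u = 0 := fun u => by nlinarith [hsq u, sq_nonneg (f u), sq_nonneg (g u)]
    have h1 := hf s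
    rw [show f = fun _ => 0 from funext hf0] at h1
    have h2 := h1.unique (hasDerivAt_const s 0)
    have h3 := (mul_eq_zero.mp h2).resolve_left (hκ s).ne'
    rw [h3] at hc1
    norm_num at hc1
  have hpos : 0 < 1 - c ^ 2 := by
    rw [← hsq 0]; have := hg0 0; positivity
  have hder : ∀ s, deriv (fun u => τ u / κ u) s = c * κ s * (1 - c ^ 2) / g s ^ 3 := by
    intro s
    have hr : (fun u => τ u / κ u) = fun u => f u / g u := by
      funext u
      rw [div_eq_div_iff (hκ u).ne' (hg0 u)]
      linarith [hfg u]
    rw [hr, ((hf s).fun_div (hg s) (hg0 s)).deriv, ← hsq s]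
    have := hg0 s
    field_simp
    linear_combination (-c * f s) * hfg s
  have hmain : ∀ s, κ s ^ 2 / √((κ s ^ 2 + τ s ^ 2) ^ 3) * deriv (fun u => τ u / κ u) s
      = c * (1 - c ^ 2) / √(1 - c ^ 2) ^ 3 * (|g s| / g s) ^ 3 := by
    intro s
    have hk := hκ s
    have hgs := hg0 s
    have hw : 0 < κ s ^ 2 + τ s ^ 2 := by positivity
    have key : |g s| * √(κ s ^ 2 + τ s ^ 2) = κ s * √(1 - c ^ 2) := by
      rw [← Real.sqrt_sq_eq_abs, ← Real.sqrt_mul (sq_nonneg _)]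
      nth_rewrite 2 [← Real.sqrt_sq hk.le]
      rw [← Real.sqrt_mul (sq_nonneg _), ← hsq s]
      congr 1
      linear_combination (-(κ s * f s + τ s * g s)) * hfg s
    have hsw : √((κ s ^ 2 + τ s ^ 2) ^ 3) = √(κ s ^ 2 + τ s ^ 2) ^ 3 := by
      rw [Real.sqrt_eq_iff_mul_self_eq (by positivity) (by positivity)]
      rw [← mul_pow, Real.mul_self_sqrt hw.le]
    have hw' := Real.sqrt_pos.mpr hw
    have hp' := Real.sqrt_pos.mpr hpos
    rw [hder, hsw, div_pow, div_mul_div_comm, div_mul_div_comm,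
      div_eq_div_iff (by positivity) (by positivity)]
    have key3 := congrArg (· ^ 3) key
    simp only [mul_pow] at key3
    linear_combination (-(c * (1 - c ^ 2) * g s ^ 3)) * key3
  have hcont : Continuous g := continuous_iff_continuousAt.mpr fun s => (hg s).continuousAt
  have hsign : (∀ s, 0 < g s) ∨ ∀ s, g s < 0 := by
    by_contra! hne
    obtain ⟨⟨x, hx⟩, y, hy⟩ := hne
    obtain ⟨z, hz⟩ := mem_range_of_exists_le_of_exists_ge hcont ⟨x, hx⟩ ⟨y, hy⟩
    exact hg0 z hz
  rcases hsign with hs | hs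
  · refine ⟨c * (1 - c ^ 2) / √(1 - c ^ 2) ^ 3, fun s => ?_⟩
    rw [hmain, abs_of_pos (hs s), div_self (hg0 s)]; ring
  · refine ⟨-(c * (1 - c ^ 2) / √(1 - c ^ 2) ^ 3), fun s => ?_⟩
    rw [hmain, abs_of_neg (hs s), neg_div, div_self (hg0 s)]; ring

/-- If the geodesic curvature of the normal indicatrix is constant, then `n` makes a constant angle
with some unit vector. -/
theorem exists_inner_const_of_sigma_const (h : IsFrenetFrame t n b κ τ) (hκ : ∀ s, 0 < κ s)
    (hdiff : Differentiable ℝ fun u => τ u / κ u) {m : ℝ}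
    (hm : ∀ s, κ s ^ 2 / √((κ s ^ 2 + τ s ^ 2) ^ 3) * deriv (fun u => τ u / κ u) s = m) :
    ∃ d : EuclideanSpace ℝ (Fin 3), ‖d‖ = 1 ∧ ∃ c, ∀ s, ⟪n s, d⟫ = c := by
  set r : ℝ → ℝ := fun u => τ u / κ u with hr_def
  have hτr : ∀ s, τ s = r s * κ s := fun s => by
    have := (hκ s).ne'
    simp only [hr_def]; field_simp
  set q : ℝ → ℝ := fun s => √(1 + r s ^ 2)
  have hq : ∀ s, 0 < q s := fun s => Real.sqrt_pos.mpr (by positivity)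
  have hqsq : ∀ s, q s ^ 2 = 1 + r s ^ 2 := fun s => Real.sq_sqrt (by positivity)
  have hr' : ∀ s, deriv r s = m * κ s * q s ^ 3 := fun s => by
    have hk := hκ s
    have hqs := hq s
    have hsw : √((κ s ^ 2 + τ s ^ 2) ^ 3) = (κ s * q s) ^ 3 := by
      rw [Real.sqrt_eq_iff_mul_self_eq (by positivity) (by positivity), ← mul_pow]
      congr 1
      rw [hτr s, mul_pow]
      linear_combination (-κ s ^ 2) * hqsq s
    rw [← hm s, hsw]
    field_simp
  have hqd : ∀ s, HasDerivAt q (r s * (m * κ s * q s ^ 2)) s := fun s => by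
    have h1 := (((hdiff s).hasDerivAt.fun_pow 2).const_add 1).sqrt (by positivity)
    have hqs := (hq s).ne'
    refine h1.congr_deriv ?_
    change _ / (2 * q s) = _
    rw [hr']
    simp only [Nat.cast_ofNat, Nat.add_one_sub_one, pow_one]
    field_simp
  set D : ℝ → EuclideanSpace ℝ (Fin 3) :=
    fun s => (r s / q s) • t s + m • n s + (1 / q s) • b s with hD
  have hD' : ∀ s, HasDerivAt D 0 s := fun s => by
    have hqs := (hq s).ne'
    have hrd : HasDerivAt r (m * κ s * q s ^ 3) s := hr' s ▸ (hdiff s).hasDerivAt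
    have h1 := (((hrd.fun_div (hqd s) hqs).fun_smul (h.tangent s)).fun_add
      ((h.normal s).fun_const_smul m)).fun_add
      (((hasDerivAt_const s (1 : ℝ)).fun_div (hqd s) hqs).fun_smul (h.binormal s))
    refine h1.congr_deriv ?_
    have e1 : (m * κ s * q s ^ 3 * q s - r s * (r s * (m * κ s * q s ^ 2))) / q s ^ 2 = m * κ s := by
      field_simp
      linear_combination (m * κ s) * hqsq s
    have e2 : (0 * q s - 1 * (r s * (m * κ s * q s ^ 2))) / q s ^ 2 = -(m * τ s) := by
      rw [hτr]; field_simp; ring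
    rw [e1, e2, hτr]
    module
  have hDc : ∀ s, D s = D 0 := fun s =>
    is_const_of_deriv_eq_zero (fun x => (hD' x).differentiableAt) (fun x => (hD' x).deriv) s 0
  have hort := fun s => orthonormal_iff_ite.mp (h.orthonormal s)
  have hnt : ∀ s, ⟪n s, t s⟫ = 0 := fun s => by simpa using hort s 1 0
  have hnn : ∀ s, ⟪n s, n s⟫ = 1 := fun s => by
    rw [real_inner_self_eq_norm_sq, show ‖n s‖ = 1 from (h.orthonormal s).1 1, one_pow]
  have hnb : ∀ s, ⟪n s, b s⟫ = 0 := fun s => by simpa using hort s 1 2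
  have hnD : ∀ s, ⟪n s, D 0⟫ = m := fun s => by
    rw [← hDc s]
    simp only [hD, inner_add_right, real_inner_smul_right, hnt, hnn, hnb]
    ring
  have hne : D 0 ≠ 0 := by
    intro h0
    have hbt : ⟪b 0, t 0⟫ = 0 := by simpa using hort 0 2 0
    have hbb : ⟪b 0, b 0⟫ = 1 := by
      rw [real_inner_self_eq_norm_sq, show ‖b 0‖ = 1 from (h.orthonormal 0).1 2, one_pow]
    have h1 : ⟪b 0, D 0⟫ = 1 / q 0 := by
      simp only [hD, inner_add_right, real_inner_smul_right, hbt, hbb,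
        real_inner_comm (b 0) (n 0) ▸ hnb 0]
      ring
    rw [h0, inner_zero_right] at h1
    have := one_div_pos.mpr (hq 0)
    linarith
  refine ⟨‖D 0‖⁻¹ • D 0, norm_smul_inv_norm hne, ‖D 0‖⁻¹ * m, fun s => ?_⟩
  rw [real_inner_smul_right, hnD]

end IsFrenetFrame

theorem stmt15
    (α : ℝ → EuclideanSpace ℝ (Fin 3)) (hα : ContDiff ℝ (⊤ : ℕ∞) α)
    (hunit : ∀ s, ‖deriv α s‖ = 1)
    (κ τ : ℝ → ℝ) (n b : ℝ → EuclideanSpace ℝ (Fin 3))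
    (hκ : ∀ s, κ s = ‖deriv (deriv α) s‖)
    (hκpos : ∀ s, 0 < κ s)
    (hn : ∀ s, n s = (κ s)⁻¹ • deriv (deriv α) s)
    (hb : ∀ s, b s = cross3 (deriv α s) (n s))
    (hτ : ∀ s, τ s = ⟪cross3 (deriv α s) (deriv (deriv α) s), deriv (deriv (deriv α)) s⟫ / κ s ^ 2)
    (σ : ℝ → ℝ)
    (hσ : ∀ s, σ s = κ s ^ 2 / Real.sqrt ((κ s ^ 2 + τ s ^ 2) ^ 3) *
      deriv (fun u => τ u / κ u) s) :
    (∃ d : EuclideanSpace ℝ (Fin 3), ‖d‖ = 1 ∧ ∀ s t, ⟪n s, d⟫ = ⟪n t, d⟫) ↔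
      (∀ s t, σ s = σ t) := by
  have h1 : ContDiff ℝ ∞ (deriv α) := (contDiff_infty_iff_deriv.mp hα).2
  have h2 : ContDiff ℝ ∞ (deriv (deriv α)) := (contDiff_infty_iff_deriv.mp h1).2
  have h3 : ContDiff ℝ ∞ (deriv (deriv (deriv α))) := (contDiff_infty_iff_deriv.mp h2).2
  have d1 := h1.differentiable (by simp)
  have d2 := h2.differentiable (by simp)
  have d3 := h3.differentiable (by simp)
  have hκ0 : ∀ s, deriv (deriv α) s ≠ 0 := fun s => norm_pos_iff.mp (hκ s ▸ hκpos s)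
  have dκ : Differentiable ℝ κ := by
    rw [funext hκ]; exact fun s => (d2 s).norm ℝ (hκ0 s)
  have dτ : Differentiable ℝ τ := by
    rw [funext hτ]
    exact fun s => (((d1 s).cross3 (d2 s)).inner ℝ (d3 s)).fun_div ((dκ s).fun_pow 2)
      (pow_ne_zero 2 (hκpos s).ne')
  have dn : Differentiable ℝ n := by
    rw [funext hn]; exact fun s => ((dκ s).fun_inv (hκpos s).ne').fun_smul (d2 s)
  have hfr : IsFrenetFrame (deriv α) n b κ τ := by
    refine .of_hasDerivAt hκpos (fun s => ?_) (fun s => ?_) (fun s => ?_) dn hb fun s => ?_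
    · rw [real_inner_self_eq_norm_sq, hunit, one_pow]
    · rw [real_inner_self_eq_norm_sq, hn, norm_smul, ← hκ, norm_inv,
        Real.norm_of_nonneg (hκpos s).le, inv_mul_cancel₀ (hκpos s).ne', one_pow]
    · rw [hn, smul_inv_smul₀ (hκpos s).ne']
      exact (d1 s).hasDerivAt
    · have hd := ((dκ s).fun_inv (hκpos s).ne').hasDerivAt.fun_smul (d2 s).hasDerivAt
      rw [← funext hn] at hd
      rw [hd.deriv, hb, hn, cross3_smul_right, hτ, inner_add_right, real_inner_smul_right,
        real_inner_smul_left, real_inner_smul_right, real_inner_smul_left,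
        real_inner_comm (deriv (deriv α) s) (cross3 _ _), inner_cross3_self]
      have := (hκpos s).ne'
      field_simp
      simp
  constructor
  · rintro ⟨d, hd, hc⟩ s u
    obtain ⟨m, hm⟩ := hfr.sigma_const_of_inner_const hκpos hd fun s => hc s 0
    rw [hσ, hσ, hm, hm]
  · intro hc
    obtain ⟨d, hd, c, hnd⟩ := hfr.exists_inner_const_of_sigma_const hκpos
      (fun s => (dτ s).fun_div (dκ s) (hκpos s).ne') fun s => (hσ s).symm.trans (hc s 0)
    exact ⟨d, hd, fun s u => by rw [hnd, hnd]⟩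
end
end
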